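/- arXiv:2603.13610 — 9 statements merged into one kernel-verified Lean document; each statement's English description precedes it below -/
import Mathlib

section
/- Let c ≥ 1, let Q : ℕ → ℕ be a state of the c-floor system (Q k ≤ c for all k) satisfying the interface condition, and let n ∈ ℕ. Then the state Q' obtained from Q by the BP transfer at the pair (n, n+1) again satisfies Q' k ≤ c for all k and satisfies the interface condition. -/
/-- The back-pressure (BP) transfer at the pair `(n, n+1)`: if site `n` has strictly
more particles than site `n+1`, one particle moves from `n` to `n+1`. -/
def bpTransfer (n : ℕ) (Q : ℕ → ℕ) : ℕ → ℕ :=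
  if Q (n + 1) < Q n then
    fun k => if k = n then Q n - 1 else if k = n + 1 then Q (n + 1) + 1 else Q k
  else Q

/-- The interface condition: `Q k ≤ Q j + 1` whenever `j < k`. -/
def InterfaceCond (Q : ℕ → ℕ) : Prop := ∀ j k : ℕ, j < k → Q k ≤ Q j + 1

theorem bpTransfer_preserves (c : ℕ) (hc : 1 ≤ c) (Q : ℕ → ℕ)
    (hQc : ∀ k, Q k ≤ c) (hQI : InterfaceCond Q) (n : ℕ) :
    (∀ k, bpTransfer n Q k ≤ c) ∧ InterfaceCond (bpTransfer n Q) := by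
  by_cases h : Q (n + 1) < Q n
  · simp only [bpTransfer, if_pos h, InterfaceCond]
    refine ⟨fun k => ?_, fun j k hjk => ?_⟩
    · have := hQc n
      have := hQc k
      split_ifs <;> omega
    · have := hQI j k hjk
      have := hQI j n
      have := hQI (n + 1) k
      split_ifs <;> subst_vars <;> omega
  · simpa only [bpTransfer, if_neg h] using And.intro hQc hQI
end

section
/- Let c ≥ 1 and let Q : ℕ → ℕ be a state of the c-floor system (Q k ≤ c for all k) satisfying the interface condition and finitely supported (Q n = 0 for all sufficiently large n). For 1 ≤ m ≤ c let A m denote the least index n with Q n < m (which exists since Q is finitely supported). Then: (i) for every m with 2 ≤ m ≤ c and every n with A m ≤ n < A (m−1), one has m − 1 ≤ Q n ≤ m; and (ii) for every n ≥ A 1, one has Q n ≤ 1. (In words, the sites decompose into consecutive zones, the floor-m zone being the sites n with A m ≤ n < A (m−1), on which the occupancy is either m−1 or m.) -/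
/-- From the first site with occupancy below `m` onwards, the occupancy is at most `m`. -/
theorem InterfaceCond.le_of_sInf_le {Q : ℕ → ℕ} (hQ : InterfaceCond Q) {m n : ℕ}
    (hne : {k | Q k < m}.Nonempty) (hn : sInf {k | Q k < m} ≤ n) : Q n ≤ m := by
  have hlt : Q (sInf {k | Q k < m}) < m := Nat.sInf_mem hne
  rcases hn.eq_or_lt with rfl | h
  · exact hlt.le
  · exact (hQ _ _ h).trans hlt

/-- Zone decomposition of a finitely supported state of the `c`-floor system:
with `A m` the least index `n` with `Q n < m`, the floor-`m` zone
`{n | A m ≤ n < A (m-1)}` has occupancy `m-1` or `m`, and beyond `A 1`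
the occupancy is at most `1`. -/
theorem zone_decomposition (c : ℕ) (hc : 1 ≤ c) (Q : ℕ → ℕ)
    (hQc : ∀ k, Q k ≤ c) (hQI : InterfaceCond Q)
    (hfin : ∃ N, ∀ k, N ≤ k → Q k = 0)
    (A : ℕ → ℕ) (hA : ∀ m, A m = sInf {n | Q n < m}) :
    (∀ m, 2 ≤ m → m ≤ c → ∀ n, A m ≤ n → n < A (m - 1) →
        m - 1 ≤ Q n ∧ Q n ≤ m) ∧
    (∀ n, A 1 ≤ n → Q n ≤ 1) := by
  obtain ⟨N, hN⟩ := hfin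
  have hne (m : ℕ) (hm : 1 ≤ m) : {k | Q k < m}.Nonempty :=
    ⟨N, (hN N le_rfl).trans_lt hm⟩
  refine ⟨fun m hm _ n hn hn' => ⟨?_, ?_⟩, fun n hn => ?_⟩
  · rw [hA] at hn'
    have hmem : n ∉ {k | Q k < m - 1} := Nat.notMem_of_lt_sInf hn'
    exact not_lt.mp hmem
  · exact hQI.le_of_sInf_le (hne m (by omega)) (hA m ▸ hn)
  · exact hQI.le_of_sInf_le (hne 1 le_rfl) (hA 1 ▸ hn)
end

section
/- Let Q, Q' : ℕ → ℕ be finitely supported with Q ⪯ Q', and let n ∈ ℕ. Let T denote the BP transfer at the pair (n, n+1). Then T Q ⪯ T Q'. (This is the key inductive step of the comparison lemma for an 'impeded' process: if the lagging configuration is behind the leading one in the tail-sum order, it remains behind after a simultaneous back-pressure transfer.) -/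
/-- Finitely supported configuration. -/
def FinSupp (Q : ℕ → ℕ) : Prop := ∃ N, ∀ k, N ≤ k → Q k = 0

/-- The tail-sum partial order: `Q ⪯ Q'` iff `∑_{k ≥ n} Q k ≤ ∑_{k ≥ n} Q' k` for all `n`. -/
def TailLE (Q Q' : ℕ → ℕ) : Prop :=
  ∀ n : ℕ, (∑' k : ℕ, Q (n + k)) ≤ ∑' k : ℕ, Q' (n + k)

theorem FinSupp.tsum_tail_eq {Q : ℕ → ℕ} (hQ : FinSupp Q) (m : ℕ) :
    ∑' k : ℕ, Q (m + k) = Q m + ∑' k : ℕ, Q (m + 1 + k) := by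
  obtain ⟨N, hN⟩ := hQ
  have hs : Summable fun k => Q (m + (k + 1)) :=
    summable_of_ne_finset_zero (s := Finset.range N) fun k hk =>
      hN _ (by simp only [Finset.mem_range] at hk; omega)
  rw [tsum_eq_zero_add' (f := fun k => Q (m + k)) hs]
  simp only [add_zero, add_assoc, add_comm 1]

theorem FinSupp.bpTransfer {Q : ℕ → ℕ} (hQ : FinSupp Q) (n : ℕ) : FinSupp (bpTransfer n Q) := by
  obtain ⟨N, hN⟩ := hQ
  refine ⟨N + n + 2, fun k hk => ?_⟩
  have h0 := hN k (by omega)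
  unfold _root_.bpTransfer
  split_ifs
  · simp [h0, show k ≠ n by omega, show k ≠ n + 1 by omega]
  · exact h0

/-- A transfer at `(n, n+1)` only affects the tail sum from `n + 1`, raising it by one when a
particle moves. -/
theorem FinSupp.tsum_tail_bpTransfer {Q : ℕ → ℕ} (hQ : FinSupp Q) (n m : ℕ) :
    ∑' k : ℕ, _root_.bpTransfer n Q (m + k) =
      (∑' k : ℕ, Q (m + k)) + if m = n + 1 ∧ Q (n + 1) < Q n then 1 else 0 := by
  by_cases hlt : Q (n + 1) < Q n
  · have hT : _root_.bpTransfer n Q = fun k =>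
        if k = n then Q n - 1 else if k = n + 1 then Q (n + 1) + 1 else Q k := if_pos hlt
    have far : ∀ m, n + 2 ≤ m →
        ∑' k : ℕ, _root_.bpTransfer n Q (m + k) = ∑' k : ℕ, Q (m + k) := fun m hm =>
      tsum_congr fun k => by
        simp [hT, show m + k ≠ n by omega, show m + k ≠ n + 1 by omega]
    have next : ∑' k : ℕ, _root_.bpTransfer n Q (n + 1 + k) =
        (∑' k : ℕ, Q (n + 1 + k)) + 1 := by
      have hv : _root_.bpTransfer n Q (n + 1) = Q (n + 1) + 1 := by simp [hT]
      rw [(hQ.bpTransfer n).tsum_tail_eq, hQ.tsum_tail_eq (n + 1), far (n + 1 + 1) le_rfl, hv]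
      omega
    have near : ∀ d m, m + d = n →
        ∑' k : ℕ, _root_.bpTransfer n Q (m + k) = ∑' k : ℕ, Q (m + k) := by
      intro d
      induction d with
      | zero =>
        intro m hm
        obtain rfl : n = m := by omega
        have hv : _root_.bpTransfer n Q n = Q n - 1 := by simp [hT]
        rw [(hQ.bpTransfer n).tsum_tail_eq, hQ.tsum_tail_eq n, next, hv]
        omega
      | succ d ih =>
        intro m hm
        have hv : _root_.bpTransfer n Q m = Q m := by
          simp [hT, show m ≠ n by omega, show m ≠ n + 1 by omega]
        rw [(hQ.bpTransfer n).tsum_tail_eq, hQ.tsum_tail_eq m, ih (m + 1) (by omega), hv]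
    rcases lt_trichotomy m (n + 1) with hm | rfl | hm
    · simpa [hm.ne] using near (n - m) m (by omega)
    · simpa [hlt] using next
    · simpa [hm.ne'] using far m hm
  · simp [_root_.bpTransfer, hlt]

/-- The tail-sum order is preserved by a simultaneous BP transfer at `(n, n+1)`. -/
theorem tailLE_bpTransfer (Q Q' : ℕ → ℕ) (hQ : FinSupp Q) (hQ' : FinSupp Q')
    (h : TailLE Q Q') (n : ℕ) :
    TailLE (bpTransfer n Q) (bpTransfer n Q') := by
  intro m
  rw [hQ.tsum_tail_bpTransfer, hQ'.tsum_tail_bpTransfer]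
  have hm := h m
  by_cases hmn : m = n + 1
  · subst hmn
    have h0 := h n
    have h2 := h (n + 1 + 1)
    have e0 := hQ.tsum_tail_eq n
    have e1 := hQ.tsum_tail_eq (n + 1)
    have e0' := hQ'.tsum_tail_eq n
    have e1' := hQ'.tsum_tail_eq (n + 1)
    simp only [true_and]
    split_ifs <;> omega
  · simpa [hmn] using hm
end

section
/- Let Q, Q' : ℕ → ℕ with Q k ≤ Q' k for all k, and let n ∈ ℕ. Let T denote the BP transfer at the pair (n, n+1). Then (T Q) k ≤ (T Q') k for all k. (In words: the coordinatewise order between two configurations is preserved when the same back-pressure transfer bell is applied to both.) -/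
/-- Coordinatewise order is preserved when the same BP transfer bell is applied
to both configurations. -/
theorem bpTransfer_mono (Q Q' : ℕ → ℕ) (h : ∀ k, Q k ≤ Q' k) (n : ℕ) :
    ∀ k, bpTransfer n Q k ≤ bpTransfer n Q' k := by
  intro k
  have hk := h k
  have hn := h n
  have hn' := h (n + 1)
  unfold bpTransfer
  by_cases hkn : k = n
  · subst hkn
    split_ifs <;> simp <;> omega
  · by_cases hkn' : k = n + 1
    · subst hkn'
      split_ifs <;> simp <;> omega
    · split_ifs <;> simpa [hkn, hkn'] using hk
end

section
/- (Correctness of the two-class priority coupling for particle movement.) Let (a, b) be a two-class configuration and n ∈ ℕ. Define the two-class BP update at the pair (n, n+1) as follows. Step 1: if a n > a (n+1), replace (a n, a (n+1)) by (a n − 1, a (n+1) + 1), and in addition, if b (n+1) > 0, replace (b n, b (n+1)) by (b n + 1, b (n+1) − 1). Step 2: if after Step 1 the total a n + b n at site n equals its value before Step 1, and the post-Step-1 totals satisfy a n + b n > a (n+1) + b (n+1), then replace (b n, b (n+1)) by (b n − 1, b (n+1) + 1). All other sites are unchanged. Let (a', b') denote the result. Then: (i) whenever Step 2 applies, the post-Step-1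 value of b n is at least 1, so the update is well defined; (ii) a' equals the BP transfer at (n, n+1) applied to a; and (iii) the total configuration a' + b' equals the BP transfer at (n, n+1) applied to a + b. -/
/-- Correctness of the two-class priority coupling for particle movement.
`a` is the class-1 (high-priority) configuration, `b` the class-2 one.
Step 1: if `a n > a (n+1)`, a class-1 particle moves right and, if present,
a class-2 particle at `n+1` moves back.  Step 2: if the total at site `n` is
unchanged by Step 1 and the post-Step-1 totals satisfy the BP condition,
a class-2 particle moves right. -/
theorem twoClass_coupling_correct (a b : ℕ → ℕ) (n : ℕ) (a' b1 b' : ℕ → ℕ)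
    (ha' : a' = bpTransfer n a)
    (hb1 : b1 = if a (n + 1) < a n ∧ 0 < b (n + 1) then
        (fun k => if k = n then b n + 1 else if k = n + 1 then b (n + 1) - 1 else b k)
      else b)
    (hb' : b' = if a' n + b1 n = a n + b n ∧ a' (n + 1) + b1 (n + 1) < a' n + b1 n then
        (fun k => if k = n then b1 n - 1 else if k = n + 1 then b1 (n + 1) + 1 else b1 k)
      else b1) :
    -- (i) Step 2, when it applies, is well defined
    ((a' n + b1 n = a n + b n ∧ a' (n + 1) + b1 (n + 1) < a' n + b1 n) → 1 ≤ b1 n) ∧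
    -- (ii) class 1 undergoes the BP transfer
    a' = bpTransfer n a ∧
    -- (iii) the total configuration undergoes the BP transfer
    (fun k => a' k + b' k) = bpTransfer n (fun k => a k + b k) := by
  have a_n : a' n = if a (n + 1) < a n then a n - 1 else a n := by
    subst ha'; unfold bpTransfer; split_ifs <;> simp
  have a_succ : a' (n + 1) = if a (n + 1) < a n then a (n + 1) + 1 else a (n + 1) := by
    subst ha'; unfold bpTransfer; split_ifs <;> simp
  have a_other : ∀ k, k ≠ n → k ≠ n + 1 → a' k = a k := by
    intro k hk hk'
    subst ha'; unfold bpTransfer; split_ifs <;> simp [hk, hk']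
  have b1_n : b1 n = if a (n + 1) < a n ∧ 0 < b (n + 1) then b n + 1 else b n := by
    subst hb1; split_ifs <;> simp
  have b1_succ : b1 (n + 1) =
      if a (n + 1) < a n ∧ 0 < b (n + 1) then b (n + 1) - 1 else b (n + 1) := by
    subst hb1; split_ifs <;> simp
  have b1_other : ∀ k, k ≠ n → k ≠ n + 1 → b1 k = b k := by
    intro k hk hk'
    subst hb1; split_ifs <;> simp [hk, hk']
  clear hb1
  refine ⟨?_, ha', ?_⟩
  · split_ifs at * <;> omega
  · clear ha'
    funext k
    have b_k := congrFun hb' k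
    clear hb'
    unfold bpTransfer
    by_cases hk : k = n
    · subst hk
      split_ifs at * <;> simp at * <;> omega
    · by_cases hk' : k = n + 1
      · subst hk'
        split_ifs at * <;> simp at * <;> omega
      · have h_a := a_other k hk hk'
        have h_b := b1_other k hk hk'
        clear a_other b1_other
        split_ifs at b_k ⊢ <;> simp [hk, hk'] at b_k ⊢ <;> omega
end

section
/- (Correctness of the arrival rule in the coupling of systems with c − 1 and c floors.) Let c ≥ 2 and let (a, b) be a two-class configuration with a n + b n ≤ c for all n. Define the arrival operation at site 0: if a 0 < c − 1, replace a 0 by a 0 + 1 and, in addition, if a 0 + b 0 = c held before the operation, replace b 0 by b 0 − 1; otherwise, if a 0 = c − 1 and b 0 = 0, replace b 0 by b 0 + 1; otherwise do nothing. Then: (i) whenever the decrement of b 0 is triggered, b 0 ≥ 2 beforehand, so the operation is well defined; (ii) a undergoes the BP arrival with capacity c − 1; and (iii) the total configuration a + b undergoes the BP arrival with capacity c. -/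
/-- The BP arrival with capacity `c`. -/
def bpArrival (c : ℕ) (Q : ℕ → ℕ) : ℕ → ℕ :=
  if Q 0 < c then fun k => if k = 0 then Q 0 + 1 else Q k else Q

/-- Correctness of the arrival rule in the coupling of the systems with `c - 1`
and `c` floors.  `a` is the class-1 configuration, `b` the class-2 one, and
`(a', b')` the result of the arrival operation at site `0`. -/
theorem floor_coupling_arrival_correct (c : ℕ) (hc : 2 ≤ c) (a b : ℕ → ℕ)
    (hcap : ∀ n, a n + b n ≤ c) (a' b' : ℕ → ℕ)
    (ha' : a' = if a 0 < c - 1 then (fun k => if k = 0 then a 0 + 1 else a k) else a)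
    (hb' : b' = if a 0 < c - 1 then
        (if a 0 + b 0 = c then (fun k => if k = 0 then b 0 - 1 else b k) else b)
      else if a 0 = c - 1 ∧ b 0 = 0 then
        (fun k => if k = 0 then b 0 + 1 else b k)
      else b) :
    -- (i) when the decrement of `b 0` is triggered, `b 0 ≥ 2`
    ((a 0 < c - 1 ∧ a 0 + b 0 = c) → 2 ≤ b 0) ∧
    -- (ii) class 1 undergoes the BP arrival with capacity `c - 1`
    a' = bpArrival (c - 1) a ∧
    -- (iii) the total configuration undergoes the BP arrival with capacity `c`
    (fun k => a' k + b' k) = bpArrival c (fun k => a k + b k) := by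
  have hcap₀ := hcap 0
  subst ha' hb'
  refine ⟨by omega, rfl, ?_⟩
  funext k
  simp only [bpArrival]
  by_cases hk : k = 0
  · subst hk
    split_ifs <;> simp <;> omega
  · split_ifs <;> simp [hk]
end

section
/- Let c ≥ 1, M ∈ ℝ, and let f, g : ℕ → ℝ satisfy the following strictness properties on {1, …, c}: whenever 1 ≤ j < k ≤ c and f j < M, then f k < f j; and whenever 1 ≤ j < k ≤ c and g k < M, then g j < g k. Suppose the maximum of ℓ ↦ min (f ℓ) (g ℓ) over {1, …, c} is strictly less than M. Then the set of maximizers of ℓ ↦ min (f ℓ) (g ℓ) over {1, …, c} has at most two elements. (This is the paper's claim that if ζ(α, β, c) < 1/4 then L* has at most two elements, since the flux φ(α, c−ℓ+1) is strictly decreasing in ℓ wherever it is below 1/4 and φ(β, ℓ) is strictly increasing in ℓ wherever it is below 1/4.) -/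
/-- If `f` is strictly decreasing wherever it is below `M`, `g` is strictly
increasing wherever it is below `M`, and the maximum of `ℓ ↦ min (f ℓ) (g ℓ)`
over `{1, …, c}` is strictly less than `M`, then the set of maximizers has at
most two elements. -/
theorem maximizer_set_card_le_two (c : ℕ) (hc : 1 ≤ c) (M : ℝ) (f g : ℕ → ℝ)
    (hf : ∀ j k, 1 ≤ j → j < k → k ≤ c → f j < M → f k < f j)
    (hg : ∀ j k, 1 ≤ j → j < k → k ≤ c → g k < M → g j < g k)
    (hlt : ∀ ℓ ∈ Finset.Icc 1 c, min (f ℓ) (g ℓ) < M) :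
    Set.encard {ℓ : ℕ | ℓ ∈ Finset.Icc 1 c ∧
      ∀ m ∈ Finset.Icc 1 c, min (f m) (g m) ≤ min (f ℓ) (g ℓ)} ≤ 2 := by
  set S := {ℓ : ℕ | ℓ ∈ Finset.Icc 1 c ∧
    ∀ m ∈ Finset.Icc 1 c, min (f m) (g m) ≤ min (f ℓ) (g ℓ)}
  have no_three : ∀ i ∈ S, ∀ j ∈ S, ∀ k ∈ S, i < j → ¬ j < k := by
    rintro i ⟨hi, hi'⟩ j ⟨hj, hj'⟩ k ⟨hk, hk'⟩ hij hjk
    have hM := hlt j hj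
    have hji := hi' j hj
    have hjk' := hk' j hj
    rw [Finset.mem_Icc] at hi hj hk
    rcases min_choice (f j) (g j) with h | h <;> rw [h] at hM hji hjk'
    · exact ((le_min_iff.mp hjk').1).not_gt (hf j k hj.1 hjk hk.2 hM)
    · exact ((le_min_iff.mp hji).2).not_gt (hg i j hi.1 hij hj.2 hM)
  have hS : S.Finite := (Finset.Icc 1 c).finite_toSet.subset fun _ h => h.1
  by_contra! h
  rw [← hS.cast_ncard_eq] at h
  obtain ⟨i, j, k, hi, hj, hk, hij, hik, hjk⟩ :=
    (Set.two_lt_ncard_iff hS).mp (by exact_mod_cast h)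
  rcases hij.lt_or_gt with _ | _ <;> rcases hik.lt_or_gt with _ | _ <;>
    rcases hjk.lt_or_gt with _ | _ <;> grind
end

section
/- Let M ∈ ℝ, let a, b, c ≥ 1 be integers, and let u, v : ℕ → ℝ satisfy: u j ≤ M and (u j = M ↔ j ≥ a) for every j ∈ {1, …, c}, and v j ≤ M and (v j = M ↔ j ≥ b) for every j ∈ {1, …, c}. Then the maximum of ℓ ↦ min (u (c − ℓ + 1)) (v ℓ) over ℓ ∈ {1, …, c} equals M if and only if c ≥ a + b − 1. (This is the paper's claim that the condition ζ(α, β, c) = 1/4 is equivalent to c ≥ c_α + c_β − 1, where u j = φ(α, j), v j = φ(β, j), a = c_α and b = c_β are the minimal numbers of floors achieving flux 1/4.) -/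
/-- The condition `ζ = M` (the maximum of `ℓ ↦ min (u (c - ℓ + 1)) (v ℓ)` over
`{1, …, c}` equals `M`) is equivalent to `c ≥ a + b - 1`, where `a` and `b` are the
minimal indices at which `u`, respectively `v`, attains the value `M`. -/
theorem max_flux_eq_iff (M : ℝ) (a b c : ℕ) (ha : 1 ≤ a) (hb : 1 ≤ b) (hc : 1 ≤ c)
    (u v : ℕ → ℝ)
    (hu : ∀ j, 1 ≤ j → j ≤ c → u j ≤ M ∧ (u j = M ↔ a ≤ j))
    (hv : ∀ j, 1 ≤ j → j ≤ c → v j ≤ M ∧ (v j = M ↔ b ≤ j)) :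
    (Finset.Icc 1 c).sup' (Finset.nonempty_Icc.mpr hc)
        (fun ℓ => min (u (c - ℓ + 1)) (v ℓ)) = M ↔ a + b - 1 ≤ c := by
  constructor
  · intro h
    obtain ⟨ℓ, hℓ, hmax⟩ := Finset.exists_mem_eq_sup' (Finset.nonempty_Icc.mpr hc)
      (fun ℓ => min (u (c - ℓ + 1)) (v ℓ))
    obtain ⟨h1, h2⟩ := Finset.mem_Icc.mp hℓ
    have hmin : M ≤ min (u (c - ℓ + 1)) (v ℓ) := (h.symm.trans hmax).le
    obtain ⟨huM, hua⟩ := hu (c - ℓ + 1) (by omega) (by omega)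
    obtain ⟨hvM, hvb⟩ := hv ℓ h1 h2
    have := hua.mp (huM.antisymm (hmin.trans (min_le_left _ _)))
    have := hvb.mp (hvM.antisymm (hmin.trans (min_le_right _ _)))
    omega
  · intro h
    apply le_antisymm
    · refine Finset.sup'_le _ _ fun ℓ hℓ => ?_
      obtain ⟨h1, h2⟩ := Finset.mem_Icc.mp hℓ
      exact (min_le_right _ _).trans (hv ℓ h1 h2).1
    · refine Finset.le_sup'_of_le _ (Finset.mem_Icc.mpr ⟨hb, by omega⟩) (le_min ?_ ?_)
      · exact ((hu (c - b + 1) (by omega) (by omega)).2.mpr (by omega)).ge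
      · exact ((hv b hb (by omega)).2.mpr le_rfl).ge
end

section
/- Let c ≥ 1 and N ≥ 1. Define a one-step relation R on functions ℕ → ℕ by: R Q Q' holds if Q' is obtained from Q by a BP transfer at some pair (n, n+1), or by the BP arrival with capacity c, or by the BP departure at site N−1. Then every state Q reachable from the zero state (the function identically 0) by finitely many steps of R (i.e., with (0, Q) in the reflexive-transitive closure of R) satisfies Q k ≤ c for all k, Q k = 0 for all k ≥ N, and the interface condition. -/
/-- The BP departure at site `N - 1`. -/
def bpDeparture (N : ℕ) (Q : ℕ → ℕ) : ℕ → ℕ :=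
  if 0 < Q (N - 1) then fun k => if k = N - 1 then Q (N - 1) - 1 else Q k else Q

/-- One step of the finite `N`-site, `c`-floor system: a BP transfer at some pair
`(n, n+1)` of neighboring sites of the system, a BP arrival, or a BP departure. -/
def bpStep (c N : ℕ) (Q Q' : ℕ → ℕ) : Prop :=
  (∃ n, n + 1 < N ∧ Q' = bpTransfer n Q) ∨ Q' = bpArrival c Q ∨ Q' = bpDeparture N Q

/-- A state is well behaved if it is bounded by `c`, vanishes from site `N` on and satisfies the
interface condition. -/
def WellBehaved (c N : ℕ) (Q : ℕ → ℕ) : Prop :=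
  (∀ k, Q k ≤ c) ∧ (∀ k, N ≤ k → Q k = 0) ∧ InterfaceCond Q

theorem InterfaceCond.bpTransfer {Q : ℕ → ℕ} (h : InterfaceCond Q) (n : ℕ) :
    InterfaceCond (bpTransfer n Q) := by
  unfold _root_.bpTransfer
  split_ifs with hlt
  · intro j k hjk
    have hjk' := h j k hjk
    have hnk := h (n + 1) k
    have hjn := h j n
    dsimp only
    split_ifs <;> subst_vars <;> omega
  · exact h

theorem WellBehaved.bpTransfer {c N : ℕ} {Q : ℕ → ℕ} (h : WellBehaved c N Q) {n : ℕ}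
    (hn : n + 1 < N) : WellBehaved c N (bpTransfer n Q) := by
  obtain ⟨hb, hv, hi⟩ := h
  refine ⟨fun k => ?_, fun k hk => ?_, hi.bpTransfer n⟩
  · have hk := hb k
    have hbn := hb n
    unfold _root_.bpTransfer
    split_ifs <;> (try dsimp only) <;> (try split_ifs) <;> omega
  · have hk' := hv k hk
    unfold _root_.bpTransfer
    split_ifs <;> (try dsimp only) <;> (try split_ifs) <;> omega

theorem WellBehaved.bpArrival {c N : ℕ} {Q : ℕ → ℕ} (h : WellBehaved c N Q) (hN : 1 ≤ N) :
    WellBehaved c N (bpArrival c Q) := by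
  unfold _root_.bpArrival
  split_ifs with hlt
  · obtain ⟨hb, hv, hi⟩ := h
    refine ⟨fun k => ?_, fun k hk => ?_, fun j k hjk => ?_⟩
    · have hk := hb k
      dsimp only
      split_ifs <;> omega
    · have hk' := hv k hk
      dsimp only
      split_ifs <;> omega
    · have hjk' := hi j k hjk
      dsimp only
      split_ifs <;> subst_vars <;> omega
  · exact h

theorem WellBehaved.bpDeparture {c N : ℕ} {Q : ℕ → ℕ} (h : WellBehaved c N Q) :
    WellBehaved c N (bpDeparture N Q) := by
  unfold _root_.bpDeparture
  split_ifs with hpos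
  · obtain ⟨hb, hv, hi⟩ := h
    refine ⟨fun k => ?_, fun k hk => ?_, fun j k hjk => ?_⟩
    · have hk := hb k
      have hbN := hb (N - 1)
      dsimp only
      split_ifs <;> omega
    · have hk' := hv k hk
      dsimp only
      split_ifs with hkN
      · subst hkN
        omega
      · exact hk'
    · have hjk' := hi j k hjk
      have hk' := hv k
      dsimp only
      split_ifs <;> subst_vars <;> omega
  · exact h

theorem WellBehaved.bpStep {c N : ℕ} (hN : 1 ≤ N) {Q Q' : ℕ → ℕ} (h : WellBehaved c N Q)
    (hstep : bpStep c N Q Q') : WellBehaved c N Q' := by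
  obtain ⟨n, hn, rfl⟩ | rfl | rfl := hstep
  · exact h.bpTransfer hn
  · exact h.bpArrival hN
  · exact h.bpDeparture

/-- Every state reachable from the zero state by finitely many steps of the finite
system dynamics is bounded by `c`, vanishes beyond site `N - 1`, and satisfies the
interface condition. -/
theorem reachable_states_wellBehaved (c N : ℕ) (hc : 1 ≤ c) (hN : 1 ≤ N)
    (Q : ℕ → ℕ) (hreach : Relation.ReflTransGen (bpStep c N) (fun _ => 0) Q) :
    (∀ k, Q k ≤ c) ∧ (∀ k, N ≤ k → Q k = 0) ∧ InterfaceCond Q := by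
  change WellBehaved c N Q
  induction hreach with
  | refl => exact ⟨fun _ => Nat.zero_le c, fun _ _ => rfl, fun _ _ _ => Nat.zero_le _⟩
  | tail _ hstep ih => exact ih.bpStep hN hstep
end
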